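/- Let ℓ ⊂ ℍ² be a complete geodesic and let S be a family of complete geodesics in ℍ² whose union is dense in a closed half-plane bounded by ℓ, such that no member of S crosses ℓ transversely. Then ℓ does not cross any member of S transversely, and either ℓ belongs to the closure of S or ℓ lies in the closure of the union of members of S all of which are disjoint from the open half-plane on the other side. -/

import Mathlib

open Filter Metric Set

noncomputable section

/-- The hyperbolic plane, modelled by the upper half-plane with its hyperbolic metric. -/
abbrev Hyp := UpperHalfPlane

/-- A complete geodesic in the hyperbolic plane: an isometric embedding of `ℝ`. -/
structure GeodesicLine : Type where
  f : ℝ → Hyp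
  isom : Isometry f

/-- View a point of the hyperbolic plane inside the one-point compactification of `ℂ`,
where the ideal boundary `∂ℍ² = ℝ ∪ {∞}` lives. -/
def bdryPt (z : Hyp) : OnePoint ℂ := ((z : ℂ) : OnePoint ℂ)

/-- `p` is the forward ideal endpoint of the geodesic `g`. -/
def endpointAtTop (g : GeodesicLine) (p : OnePoint ℂ) : Prop :=
  Tendsto (fun t => bdryPt (g.f t)) atTop (nhds p)

/-- `p` is the backward ideal endpoint of the geodesic `g`. -/
def endpointAtBot (g : GeodesicLine) (p : OnePoint ℂ) : Prop :=
  Tendsto (fun t => bdryPt (g.f t)) atBot (nhds p)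

/-- `p` is an ideal endpoint of the geodesic `g`. -/
def IdealEndpoint (g : GeodesicLine) (p : OnePoint ℂ) : Prop :=
  endpointAtTop g p ∨ endpointAtBot g p

/-- Two geodesics are asymptotic when they share an ideal endpoint. -/
def Asymptotic (g₁ g₂ : GeodesicLine) : Prop :=
  ∃ p : OnePoint ℂ, IdealEndpoint g₁ p ∧ IdealEndpoint g₂ p


/-- Two complete geodesics in the hyperbolic plane cross transversely iff they are
distinct (as subsets) and intersect: distinct geodesics meet in at most one point, and a
tangential intersection forces equality. -/
def TransverseCross (g h : GeodesicLine) : Prop :=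
  Set.range g.f ≠ Set.range h.f ∧ (Set.range g.f ∩ Set.range h.f).Nonempty

/-- The geodesic `ℓ` lies in the closure of the family `S` of geodesics: it is
approximated on every compact piece, to every precision, by members of `S`. -/
def InClosureOfFamily (ℓ : GeodesicLine) (S : Set GeodesicLine) : Prop :=
  ∀ ε : ℝ, 0 < ε → ∀ R : ℝ, 0 < R → ∃ g ∈ S,
    ∀ t ∈ Set.Icc (-R) R, Metric.infDist (ℓ.f t) (Set.range g.f) < ε

/-- A vector that is orthogonal to a timelike vector and isotropic for the form `x z - y ^ 2`
vanishes. -/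
lemma eq_zero_of_isotropic_of_orthogonal {a b c x y z : ℝ} (h₀ : a * c - b ^ 2 = 1)
    (hB : x * c + a * z = 2 * (b * y)) (hN : x * z = y ^ 2) : x = 0 ∧ y = 0 ∧ z = 0 := by
  have h1 : (x * c - a * z) ^ 2 = -4 * y ^ 2 := by
    have : (x * c - a * z) ^ 2 = (x * c + a * z) ^ 2 - 4 * (x * z) * (a * c) := by ring
    rw [this, hB, hN]
    linear_combination -4 * y ^ 2 * h₀
  have hy : y = 0 := by nlinarith [sq_nonneg (x * c - a * z), sq_nonneg y]
  subst hy
  have h2 : x * c = a * z := by nlinarith [sq_nonneg (x * c - a * z)]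
  have hac : 0 < a * c := by nlinarith [sq_nonneg b]
  have ha : a ≠ 0 := by rintro rfl; simp at hac
  have hc : c ≠ 0 := by rintro rfl; simp at hac
  have hx : x * c = 0 := by linarith
  have hz : a * z = 0 := by linarith
  exact ⟨by simpa [hc] using hx, rfl, by simpa [ha] using hz⟩

/-- Hyperboloid coordinates of points on a unit speed line are combinations of the coordinates
of two of its points. -/
lemma line_coord_eq_sinh_comb {a b c : ℝ → ℝ}
    (h : ∀ s t, (a s * c t + a t * c s) / 2 - b s * b t = Real.cosh (s - t)) (t : ℝ) :
    a t * Real.sinh 1 = Real.sinh (1 - t) * a 0 + Real.sinh t * a 1 ∧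
    b t * Real.sinh 1 = Real.sinh (1 - t) * b 0 + Real.sinh t * b 1 ∧
    c t * Real.sinh 1 = Real.sinh (1 - t) * c 0 + Real.sinh t * c 1 := by
  have h00 := h 0 0
  have h11 := h 1 1
  have htt := h t t
  have h01 := h 1 0
  have h0t := h t 0
  have h1t := h 1 t
  simp only [sub_self, sub_zero, Real.cosh_zero, Real.cosh_sub 1 t] at h00 h11 htt h01 h0t h1t
  have e1 := Real.cosh_sq 1
  have e2 := Real.cosh_sq t
  obtain ⟨hx, hy, hz⟩ := eq_zero_of_isotropic_of_orthogonal (a := a 0) (b := b 0) (c := c 0)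
    (x := a t * Real.sinh 1 - (Real.sinh (1 - t) * a 0 + Real.sinh t * a 1))
    (y := b t * Real.sinh 1 - (Real.sinh (1 - t) * b 0 + Real.sinh t * b 1))
    (z := c t * Real.sinh 1 - (Real.sinh (1 - t) * c 0 + Real.sinh t * c 1))
    (by linarith)
    (by
      rw [Real.sinh_sub]
      generalize Real.sinh 1 = S at *
      generalize Real.cosh 1 = C at *
      generalize Real.sinh t = σ at *
      generalize Real.cosh t = κ at *
      linear_combination 2 * S * h0t - 2 * (S * κ - C * σ) * h00 - 2 * σ * h01)
    (by
      rw [Real.sinh_sub]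
      generalize Real.sinh 1 = S at *
      generalize Real.cosh 1 = C at *
      generalize Real.sinh t = σ at *
      generalize Real.cosh t = κ at *
      linear_combination S ^ 2 * htt + (S * κ - C * σ) ^ 2 * h00 + σ ^ 2 * h11
        - 2 * S * (S * κ - C * σ) * h0t - 2 * S * σ * h1t
        + 2 * (S * κ - C * σ) * σ * h01 - σ ^ 2 * e1 - S ^ 2 * e2)
  exact ⟨by linarith, by linarith, by linarith⟩

lemma sinh_comb_eq_exp_comb {x y z t : ℝ}
    (h : x * Real.sinh 1 = Real.sinh (1 - t) * y + Real.sinh t * z) :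
    x = (z - Real.exp (-1) * y) / (2 * Real.sinh 1) * Real.exp t
      + (Real.exp 1 * y - z) / (2 * Real.sinh 1) * Real.exp (-t) := by
  have hs : Real.sinh 1 ≠ 0 := (Real.sinh_pos_iff.2 one_pos).ne'
  field_simp
  have e1 : Real.exp (1 - t) = Real.exp 1 * Real.exp (-t) := by rw [← Real.exp_add]; ring_nf
  have e2 : Real.exp (-(1 - t)) = Real.exp (-1) * Real.exp t := by
    rw [← Real.exp_add]; ring_nf
  rw [Real.sinh_eq (1 - t), Real.sinh_eq t, e1, e2] at h
  linear_combination 2 * h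

lemma nonneg_coeff_of_exp_comb_pos {p q : ℝ}
    (h : ∀ t : ℝ, 0 < p * Real.exp t + q * Real.exp (-t)) : 0 ≤ p := by
  by_contra! hp
  have hpos : 0 < (|q| + 1) / -p + 1 := by
    have : 0 < -p := by linarith
    positivity
  have := h (Real.log ((|q| + 1) / -p + 1))
  rw [Real.exp_neg, Real.exp_log hpos] at this
  have h1 : 1 ≤ (|q| + 1) / -p + 1 := by
    have : 0 < -p := by linarith
    have : 0 ≤ (|q| + 1) / -p := by positivity
    linarith
  have h2 : p * ((|q| + 1) / -p + 1) = -(|q| + 1) + p := by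
    have : p ≠ 0 := hp.ne
    field_simp
  have h3 : q * ((|q| + 1) / -p + 1)⁻¹ ≤ |q| := by
    calc q * ((|q| + 1) / -p + 1)⁻¹ ≤ |q| * ((|q| + 1) / -p + 1)⁻¹ := by
          gcongr; exact le_abs_self q
      _ ≤ |q| * 1 := by gcongr; exact inv_le_one_of_one_le₀ h1
      _ = |q| := mul_one _
  linarith

/-- The hyperboloid coordinates of a geodesic are combinations of `exp t` and `exp (-t)`, whose
coefficient vectors are isotropic. -/
lemma GeodesicLine.exists_coord (g : GeodesicLine) :
    ∃ a₁ a₂ b₁ b₂ c₁ c₂ : ℝ, 0 ≤ a₁ ∧ 0 ≤ a₂ ∧ 0 ≤ c₁ ∧ 0 ≤ c₂ ∧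
      a₁ * c₁ = b₁ ^ 2 ∧ a₂ * c₂ = b₂ ^ 2 ∧ a₁ * c₂ + a₂ * c₁ - 2 * b₁ * b₂ = 1 ∧
      ∀ t, 1 / (g.f t).im = a₁ * Real.exp t + a₂ * Real.exp (-t) ∧
        (g.f t).re / (g.f t).im = b₁ * Real.exp t + b₂ * Real.exp (-t) ∧
        ((g.f t).re ^ 2 + (g.f t).im ^ 2) / (g.f t).im =
          c₁ * Real.exp t + c₂ * Real.exp (-t) := by
  have key := line_coord_eq_sinh_comb (a := fun t => 1 / (g.f t).im)
    (b := fun t => (g.f t).re / (g.f t).im)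
    (c := fun t => ((g.f t).re ^ 2 + (g.f t).im ^ 2) / (g.f t).im) (by
      intro s t
      have hd : Real.cosh (s - t) = Real.cosh (dist (g.f s) (g.f t)) := by
        rw [g.isom.dist_eq, Real.dist_eq, Real.cosh_abs]
      rw [hd, UpperHalfPlane.cosh_dist']
      have h1 := (g.f s).im_ne_zero
      have h2 := (g.f t).im_ne_zero
      field_simp
      ring)
  have ha := fun t => sinh_comb_eq_exp_comb (key t).1
  have hb := fun t => sinh_comb_eq_exp_comb (key t).2.1
  have hc := fun t => sinh_comb_eq_exp_comb (key t).2.2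
  clear key
  generalize (1 / (g.f 1).im - Real.exp (-1) * (1 / (g.f 0).im)) / (2 * Real.sinh 1) = a₁ at ha
  generalize (Real.exp 1 * (1 / (g.f 0).im) - 1 / (g.f 1).im) / (2 * Real.sinh 1) = a₂ at ha
  generalize ((g.f 1).re / (g.f 1).im - Real.exp (-1) * ((g.f 0).re / (g.f 0).im))
    / (2 * Real.sinh 1) = b₁ at hb
  generalize (Real.exp 1 * ((g.f 0).re / (g.f 0).im) - (g.f 1).re / (g.f 1).im)
    / (2 * Real.sinh 1) = b₂ at hb
  generalize (((g.f 1).re ^ 2 + (g.f 1).im ^ 2) / (g.f 1).im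
    - Real.exp (-1) * (((g.f 0).re ^ 2 + (g.f 0).im ^ 2) / (g.f 0).im))
    / (2 * Real.sinh 1) = c₁ at hc
  generalize (Real.exp 1 * (((g.f 0).re ^ 2 + (g.f 0).im ^ 2) / (g.f 0).im)
    - ((g.f 1).re ^ 2 + (g.f 1).im ^ 2) / (g.f 1).im) / (2 * Real.sinh 1) = c₂ at hc
  have hapos : ∀ t, 0 < a₁ * Real.exp t + a₂ * Real.exp (-t) := fun t => by
    rw [← ha]; exact one_div_pos.2 (g.f t).im_pos
  have hcpos : ∀ t, 0 < c₁ * Real.exp t + c₂ * Real.exp (-t) := fun t => by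
    rw [← hc]
    have := (g.f t).im_pos
    positivity
  have hswap : ∀ {p q : ℝ}, (∀ t, 0 < p * Real.exp t + q * Real.exp (-t)) → 0 ≤ q :=
    fun h => nonneg_coeff_of_exp_comb_pos fun t => by simpa [add_comm] using h (-t)
  have hN : ∀ t, (a₁ * Real.exp t + a₂ * Real.exp (-t)) * (c₁ * Real.exp t + c₂ * Real.exp (-t))
      - (b₁ * Real.exp t + b₂ * Real.exp (-t)) ^ 2 = 1 := fun t => by
    rw [← ha, ← hb, ← hc]
    have := (g.f t).im_ne_zero
    field_simp
    ring
  have n0 := hN 0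
  have n1 := hN (Real.log 2)
  have n2 := hN (-Real.log 2)
  simp only [neg_neg, Real.exp_neg, Real.exp_log two_pos, Real.exp_zero, inv_one] at n0 n1 n2
  refine ⟨a₁, a₂, b₁, b₂, c₁, c₂, nonneg_coeff_of_exp_comb_pos hapos, hswap hapos,
    nonneg_coeff_of_exp_comb_pos hcpos, hswap hcpos, ?_, ?_, ?_, fun t => ⟨ha t, hb t, hc t⟩⟩ <;>
  linarith

/-- The standard geodesic, namely the imaginary axis. -/
def imagAxis (t : ℝ) : Hyp := ⟨⟨0, Real.exp t⟩, Real.exp_pos t⟩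

lemma exists_sqrt_vector {a b c : ℝ} (ha : 0 ≤ a) (hc : 0 ≤ c) (h : a * c = b ^ 2) :
    ∃ x y : ℝ, x ^ 2 = a ∧ x * y = b ∧ y ^ 2 = c := by
  have h1 : √a * √c = |b| := by rw [← Real.sqrt_mul ha, h, Real.sqrt_sq_eq_abs]
  rcases abs_choice b with hb | hb
  · exact ⟨√a, √c, Real.sq_sqrt ha, by rw [h1, hb], Real.sq_sqrt hc⟩
  · exact ⟨√a, -√c, Real.sq_sqrt ha, by rw [mul_neg, h1, hb, neg_neg], by
      rw [neg_sq, Real.sq_sqrt hc]⟩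

open scoped MatrixGroups in
/-- Every geodesic is a Möbius image of the imaginary axis. -/
lemma GeodesicLine.exists_smul_imagAxis (g : GeodesicLine) :
    ∃ γ : SL(2, ℝ), ∀ t, g.f t = γ • imagAxis t := by
  obtain ⟨a₁, a₂, b₁, b₂, c₁, c₂, ha₁, ha₂, hc₁, hc₂, h₁, h₂, h₃, hg⟩ := g.exists_coord
  obtain ⟨C, A, rfl, rfl, rfl⟩ := exists_sqrt_vector ha₁ hc₁ h₁
  obtain ⟨D, B, hD, hDB, hB⟩ : ∃ D B : ℝ, D ^ 2 = a₂ ∧ D * B = b₂ ∧ B ^ 2 = c₂ :=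
    exists_sqrt_vector ha₂ hc₂ h₂
  obtain ⟨D, B, rfl, rfl, rfl, hdet⟩ :
      ∃ D B : ℝ, D ^ 2 = a₂ ∧ D * B = b₂ ∧ B ^ 2 = c₂ ∧ A * D - B * C = 1 := by
    have : (A * D - B * C) ^ 2 = 1 := by
      subst hD hDB hB
      linear_combination h₃
    rcases mul_self_eq_one_iff.1 ((sq _).symm.trans this) with h | h
    · exact ⟨D, B, hD, hDB, hB, h⟩
    · exact ⟨-D, -B, by simpa, by simpa, by simpa, by linarith⟩
  obtain ⟨γ, h00, h01, h10, h11⟩ :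
      ∃ γ : SL(2, ℝ), γ 0 0 = A ∧ γ 0 1 = B ∧ γ 1 0 = C ∧ γ 1 1 = D :=
    ⟨⟨!![A, B; C, D], by simp [Matrix.det_fin_two, hdet]⟩, rfl, rfl, rfl, rfl⟩
  refine ⟨γ, fun t => ?_⟩
  obtain ⟨ha, hb, -⟩ := hg t
  have him := (g.f t).im_ne_zero
  have hexp := (Real.exp_pos t).ne'
  have hden : (C : ℂ) * imagAxis t + D ≠ 0 := fun h => by
    have hre := congrArg Complex.re h
    have him' := congrArg Complex.im h
    simp [imagAxis, hexp] at hre him'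
    simp [hre, him'] at hdet
  apply UpperHalfPlane.ext
  rw [UpperHalfPlane.coe_specialLinearGroup_apply, h00, h01, h10, h11]
  simp only [Algebra.algebraMap_self, RingHom.id_apply]
  rw [eq_div_iff hden]
  rw [Real.exp_neg] at ha hb
  field_simp at ha hb
  apply Complex.ext
  · simp [imagAxis]
    apply mul_right_cancel₀ hexp
    linear_combination D * hb - B * ha + (g.f t).im * C * Real.exp t ^ 2 * hdet
  · simp [imagAxis]
    apply mul_right_cancel₀ hexp
    linear_combination C * Real.exp t * hb - A * Real.exp t * ha
      - (g.f t).im * D * Real.exp t * hdet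

lemma cosh_dist_imagAxis (t : ℝ) (z : Hyp) :
    Real.cosh (dist (imagAxis t) z) =
      (1 / z.im * Real.exp t + (z.re ^ 2 + z.im ^ 2) / z.im * Real.exp (-t)) / 2 := by
  rw [UpperHalfPlane.cosh_dist', Real.exp_neg]
  have h1 := z.im_ne_zero
  have h2 := (Real.exp_pos t).ne'
  simp only [imagAxis, UpperHalfPlane.mk_re, UpperHalfPlane.mk_im]
  field_simp
  ring

lemma mul_nonneg_of_exp_comb_ne_zero {p q : ℝ}
    (h : ∀ t : ℝ, p * Real.exp t + q * Real.exp (-t) ≠ 0) : 0 ≤ p * q := by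
  by_contra! hpq
  have hp : p ≠ 0 := by rintro rfl; simp at hpq
  have hpos : 0 < -q / p := by
    have : -q / p = -(p * q) / p ^ 2 := by field_simp
    rw [this]
    have : 0 < -(p * q) := by linarith
    positivity
  apply h (Real.log (√(-q / p)))
  rw [Real.exp_neg, Real.exp_log (Real.sqrt_pos.2 hpos)]
  have hs := (Real.sqrt_pos.2 hpos).ne'
  have hsq := Real.sq_sqrt hpos.le
  generalize √(-q / p) = r at *
  field_simp at hsq ⊢
  rw [hsq]
  simp

/-- If an orthogonal frame of isotropic vectors satisfies `a₁ c₂ ≤ a₂ c₁` and is nearly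
compatible with the standard frame, then the combination `a₁ + c₂` is small. -/
lemma frame_defect_le {a₁ a₂ b₁ b₂ c₁ c₂ κ : ℝ} (ha₂ : 0 ≤ a₂) (hc₁ : 0 ≤ c₁)
    (h₁ : a₁ * c₁ = b₁ ^ 2) (h₂ : a₂ * c₂ = b₂ ^ 2) (h₃ : a₁ * c₂ + a₂ * c₁ - 2 * b₁ * b₂ = 1)
    (hb : 0 ≤ b₁ * b₂) (hκ : 0 ≤ κ) (hκ1 : κ ≤ 1) (h0 : a₁ + a₂ + (c₁ + c₂) ≤ 2 + 2 * κ)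
    (h0' : 0 ≤ a₁ + c₂)
    (hle : a₁ * c₂ ≤ a₂ * c₁) : a₁ + c₂ ≤ 38 * κ := by
  have hbb : (b₁ + b₂) ^ 2 ≤ 3 * κ := by
    have : (a₁ + a₂) * (c₁ + c₂) = 1 + (b₁ + b₂) ^ 2 := by linear_combination h₁ + h₂ + h₃
    nlinarith [sq_nonneg (a₁ + a₂ - (c₁ + c₂)), mul_nonneg hκ (sub_nonneg.2 hκ1)]
  have hb12 : b₁ * b₂ ≤ 3 * κ := by nlinarith [sq_nonneg b₁, sq_nonneg b₂]
  have hprod : (a₁ * c₂) * (a₂ * c₁) = (b₁ * b₂) ^ 2 := by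
    rw [mul_pow, ← h₁, ← h₂]; ring
  have hlarge : 1 / 2 ≤ a₂ * c₁ := by nlinarith
  have hsmall : a₁ * c₂ ≤ 18 * κ := by nlinarith
  have hQ : 1 - 18 * κ ≤ a₂ * c₁ := by nlinarith
  have hQ2 : 2 - 36 * κ ≤ a₂ + c₁ := by
    by_contra! hlt
    nlinarith [sq_nonneg (a₂ - c₁)]
  linarith

/-- A geodesic disjoint from the imaginary axis and passing close to `I` stays close to
the imaginary axis on compact pieces. -/
lemma GeodesicLine.exists_cosh_dist_imagAxis_le (g : GeodesicLine) (hg : ∀ t, (g.f t).re ≠ 0)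
    {κ R : ℝ} (hκ : 0 ≤ κ) (hκ1 : κ ≤ 1) (h : Real.cosh (dist (imagAxis 0) (g.f 0)) ≤ 1 + κ)
    {t : ℝ} (ht : |t| ≤ R) :
    ∃ s, Real.cosh (dist (imagAxis t) (g.f s)) ≤ 1 + 20 * κ * Real.exp (2 * R) := by
  obtain ⟨a₁, a₂, b₁, b₂, c₁, c₂, ha₁, ha₂, hc₁, hc₂, h₁, h₂, h₃, hg'⟩ := g.exists_coord
  have hb : 0 ≤ b₁ * b₂ := mul_nonneg_of_exp_comb_ne_zero fun t => by
    rw [← (hg' t).2.1]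
    exact div_ne_zero (hg t) (g.f t).im_ne_zero
  rw [cosh_dist_imagAxis, (hg' 0).1, (hg' 0).2.2] at h
  simp only [neg_zero, Real.exp_zero, mul_one] at h
  obtain ⟨ht1, ht2⟩ := abs_le.1 ht
  have hR : 1 ≤ Real.exp (2 * R) := Real.one_le_exp (by linarith)
  have hexp : Real.exp (2 * t) ≤ Real.exp (2 * R) := Real.exp_le_exp.2 (by linarith)
  have hexp' : Real.exp (-(2 * t)) ≤ Real.exp (2 * R) := Real.exp_le_exp.2 (by linarith)
  have e1 : Real.exp t * Real.exp t = Real.exp (2 * t) := by rw [← Real.exp_add]; ring_nf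
  have e2 : Real.exp (-t) * Real.exp (-t) = Real.exp (-(2 * t)) := by
    rw [← Real.exp_add]; ring_nf
  have e3 : Real.exp t * Real.exp (-t) = 1 := by rw [← Real.exp_add]; simp
  rcases le_total (a₁ * c₂) (a₂ * c₁) with hle | hle
  · refine ⟨t, ?_⟩
    have hP := frame_defect_le ha₂ hc₁ h₁ h₂ h₃ hb hκ hκ1 (by linarith) (by linarith) hle
    rw [cosh_dist_imagAxis, (hg' t).1, (hg' t).2.2]
    have : (a₁ * Real.exp t + a₂ * Real.exp (-t)) * Real.exp t +
        (c₁ * Real.exp t + c₂ * Real.exp (-t)) * Real.exp (-t) =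
        a₁ * Real.exp (2 * t) + c₂ * Real.exp (-(2 * t)) + (a₂ + c₁) := by
      linear_combination a₁ * e1 + c₂ * e2 + (a₂ + c₁) * e3
    rw [this]
    have i1 := mul_le_mul_of_nonneg_left hexp ha₁
    have i2 := mul_le_mul_of_nonneg_left hexp' hc₂
    have i3 := mul_le_mul_of_nonneg_right hP (by linarith : 0 ≤ Real.exp (2 * R))
    have i4 := mul_le_mul_of_nonneg_left hR hκ
    linarith
  · refine ⟨-t, ?_⟩
    have hP := frame_defect_le (a₁ := a₂) (a₂ := a₁) (c₁ := c₂) (c₂ := c₁) (b₁ := b₂) (b₂ := b₁)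
      ha₁ hc₂ h₂ h₁ (by linarith) (by linarith) hκ hκ1 (by linarith) (by linarith) hle
    rw [cosh_dist_imagAxis, (hg' (-t)).1, (hg' (-t)).2.2, neg_neg]
    have : (a₁ * Real.exp (-t) + a₂ * Real.exp t) * Real.exp t +
        (c₁ * Real.exp (-t) + c₂ * Real.exp t) * Real.exp (-t) =
        a₂ * Real.exp (2 * t) + c₁ * Real.exp (-(2 * t)) + (a₁ + c₂) := by
      linear_combination a₂ * e1 + c₁ * e2 + (a₁ + c₂) * e3
    rw [this]
    have i1 := mul_le_mul_of_nonneg_left hexp ha₂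
    have i2 := mul_le_mul_of_nonneg_left hexp' hc₁
    have i3 := mul_le_mul_of_nonneg_right hP (by linarith : 0 ≤ Real.exp (2 * R))
    have i4 := mul_le_mul_of_nonneg_left hR hκ
    linarith

lemma range_imagAxis : range imagAxis = {z : Hyp | z.re = 0} := by
  ext z
  constructor
  · rintro ⟨t, rfl⟩
    rfl
  · intro hz
    refine ⟨Real.log z.im, UpperHalfPlane.ext_re_im (Eq.symm hz) ?_⟩
    exact Real.exp_log z.im_pos

/-- The open half-planes bounded by the imaginary axis are connected. -/
lemma isPreconnected_halfPlane (σ : ℝ) : IsPreconnected {z : Hyp | 0 < σ * z.re} := by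
  rw [← UpperHalfPlane.isEmbedding_coe.isInducing.isPreconnected_image]
  have : UpperHalfPlane.coe '' {z : Hyp | 0 < σ * z.re} =
      {z : ℂ | 0 < σ * z.re} ∩ {z : ℂ | 0 < z.im} := by
    ext z
    constructor
    · rintro ⟨w, hw, rfl⟩
      exact ⟨hw, w.im_pos⟩
    · rintro ⟨h1, h2⟩
      exact ⟨⟨z, h2⟩, h1, rfl⟩
  rw [this]
  refine (Convex.inter ?_ (convex_halfSpace_im_gt 0)).isPreconnected
  exact (convex_Ioi (0 : ℝ)).linear_preimage (σ • Complex.reLm)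

lemma imagAxis_zero_mem_closure_halfPlane {σ : ℝ} (hσ : σ ≠ 0) :
    imagAxis 0 ∈ closure {z : Hyp | 0 < σ * z.re} := by
  let p : ℝ → Hyp := fun x => ⟨⟨σ * x, 1⟩, one_pos⟩
  have hp : Continuous p := Continuous.upperHalfPlaneMk (by
    have : (fun x : ℝ => (⟨σ * x, 1⟩ : ℂ)) = fun x : ℝ => ((σ * x : ℝ) : ℂ) + Complex.I := by
      funext x
      apply Complex.ext <;> simp
    rw [this]
    fun_prop) _
  have h0 : imagAxis 0 = p 0 := by
    apply UpperHalfPlane.ext_re_im <;> simp [imagAxis, p]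
  rw [h0]
  have hmem : (0 : ℝ) ∈ closure (Ioi (0 : ℝ)) := by simp
  refine closure_mono ?_ (image_closure_subset_closure_image hp ⟨0, hmem, rfl⟩)
  rintro _ ⟨x, hx, rfl⟩
  have : 0 < σ ^ 2 * x := mul_pos (by positivity) hx
  simpa [p, ← mul_assoc, ← sq] using this

open scoped MatrixGroups in
/-- Every point of a geodesic bounds each complementary component of that geodesic. -/
lemma smul_imagAxis_zero_mem_closure_component (γ : SL(2, ℝ)) {L : Set Hyp}
    (hL : L = range fun t => γ • imagAxis t) {x : Hyp} (hx : x ∉ L) :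
    γ • imagAxis 0 ∈ closure (connectedComponentIn Lᶜ x) := by
  have hmem : ∀ z : Hyp, γ • z ∈ L ↔ z.re = 0 := fun z => by
    have : z.re = 0 ↔ z ∈ range imagAxis := by rw [range_imagAxis]; rfl
    rw [hL, this]
    simp [mem_range]
  have hcont : Continuous fun z : Hyp => γ • z := (isometry_smul Hyp γ).continuous
  obtain ⟨y, rfl⟩ : ∃ y : Hyp, γ • y = x := ⟨γ⁻¹ • x, smul_inv_smul γ x⟩
  rw [hmem] at hx
  have hsub : (fun z : Hyp => γ • z) '' {z : Hyp | 0 < y.re * z.re} ⊆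
      connectedComponentIn Lᶜ (γ • y) := by
    refine ((isPreconnected_halfPlane y.re).image _ hcont.continuousOn).subset_connectedComponentIn
      ⟨y, mul_self_pos.2 hx, rfl⟩ ?_
    rintro _ ⟨z, hz, rfl⟩ hzL
    have hz' : 0 < y.re * z.re := hz
    rw [(hmem z).1 hzL, mul_zero] at hz'
    exact lt_irrefl _ hz'
  exact closure_mono hsub
    (image_closure_subset_closure_image hcont ⟨_, imagAxis_zero_mem_closure_halfPlane hx, rfl⟩)

open scoped MatrixGroups in
/-- A line that is a limit of points of geodesics not crossing it is a limit of these
geodesics. -/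
lemma inClosureOfFamily_of_mem_closure {ℓ : GeodesicLine} {S : Set GeodesicLine} (γ : SL(2, ℝ))
    (hγ : ∀ t, ℓ.f t = γ • imagAxis t) (hcl : ℓ.f 0 ∈ closure (⋃ g ∈ S, range g.f))
    (hS : ∀ g ∈ S, ¬ TransverseCross g ℓ) : InClosureOfFamily ℓ S := by
  intro ε hε R hR
  set K := Real.cosh ε - 1 with hK
  have hKpos : 0 < K := sub_pos.2 (Real.one_lt_cosh.2 hε.ne')
  set κ := min 1 (K / (40 * Real.exp (2 * R))) with hκ
  have hκpos : 0 < κ := lt_min one_pos (by positivity)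
  have hopen : IsOpen {z : Hyp | Real.cosh (dist (ℓ.f 0) z) < 1 + κ} :=
    isOpen_lt (by fun_prop) continuous_const
  obtain ⟨z, hz, hzS⟩ := mem_closure_iff.1 hcl _ hopen (by simpa using hκpos)
  simp only [mem_iUnion] at hzS
  obtain ⟨g, hgS, s, rfl⟩ := hzS
  refine ⟨g, hgS, fun t ht => ?_⟩
  by_cases hrange : range g.f = range ℓ.f
  · rw [hrange, infDist_zero_of_mem (mem_range_self t)]
    exact hε
  have hdisj : ∀ u v, g.f u ≠ ℓ.f v := fun u v huv =>
    hS g hgS ⟨hrange, g.f u, mem_range_self u, v, huv.symm⟩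
  let g' : GeodesicLine := ⟨fun t => γ⁻¹ • g.f (s + t),
    (isometry_smul Hyp γ⁻¹).comp (g.isom.comp (IsometryEquiv.addLeft s).isometry)⟩
  have hg' : ∀ t u, dist (imagAxis t) (g'.f u) = dist (ℓ.f t) (g.f (s + u)) := fun t u => by
    rw [hγ, ← dist_smul γ (imagAxis t)]
    simp [g']
  have hre : ∀ t, (g'.f t).re ≠ 0 := fun t h => by
    have : g'.f t ∈ range imagAxis := by rw [range_imagAxis]; exact h
    obtain ⟨v, hv⟩ := this
    refine hdisj (s + t) v ?_
    rw [hγ, hv]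
    simp [g']
  obtain ⟨u, hu⟩ := g'.exists_cosh_dist_imagAxis_le hre hκpos.le (min_le_left _ _)
    (by rw [hg', add_zero]; exact le_of_lt hz) (abs_le.2 ht)
  refine (infDist_le_dist_of_mem (mem_range_self (s + u))).trans_lt ?_
  rw [hg'] at hu
  have hE := Real.exp_pos (2 * R)
  have hκK : 20 * κ * Real.exp (2 * R) ≤ K / 2 := by
    have : κ ≤ K / (40 * Real.exp (2 * R)) := min_le_right _ _
    rw [le_div_iff₀ (by positivity)] at this
    linarith
  have : Real.cosh (dist (ℓ.f t) (g.f (s + u))) < Real.cosh ε := by linarith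
  rwa [Real.cosh_lt_cosh, abs_of_nonneg dist_nonneg, abs_of_pos hε] at this

/-- Let `ℓ` be a complete geodesic and `S` a family of complete geodesics
in the hyperbolic plane whose union is dense in a closed half-plane bounded by `ℓ`, such
that no member of `S` crosses `ℓ` transversely. Then `ℓ` does not cross any member of `S`
transversely, and either `ℓ` belongs to the closure of `S`, or `ℓ` lies in the closure of
the union of the members of `S` disjoint from the open half-plane on the other side. -/
theorem stmt13 (ℓ : GeodesicLine) (S : Set GeodesicLine) (x₀ : Hyp)
    (hx₀ : x₀ ∉ Set.range ℓ.f)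
    (O : Set Hyp) (hO : O = connectedComponentIn (Set.range ℓ.f)ᶜ x₀)
    (O' : Set Hyp) (hO' : O' = (Set.range ℓ.f)ᶜ \ O)
    (hdense : closure O ⊆ closure (⋃ g ∈ S, Set.range g.f))
    (hnocross : ∀ g ∈ S, ¬ TransverseCross g ℓ) :
    (∀ g ∈ S, ¬ TransverseCross ℓ g) ∧
      (InClosureOfFamily ℓ S ∨
        InClosureOfFamily ℓ {g ∈ S | Set.range g.f ∩ O' = ∅}) := by
  refine ⟨fun g hg h => hnocross g hg ⟨h.1.symm, by rw [inter_comm]; exact h.2⟩, Or.inl ?_⟩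
  obtain ⟨γ, hγ⟩ := ℓ.exists_smul_imagAxis
  refine inClosureOfFamily_of_mem_closure γ hγ (hdense ?_) hnocross
  rw [hO, hγ 0]
  exact smul_imagAxis_zero_mem_closure_component γ (congrArg range (funext hγ)) hx₀

end
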